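/- Let Φ denote the standard normal cumulative distribution function and φ(x) = (2π)^{−1/2} e^{−x²/2} its density, and set ρ(t,t) = t(1−t) − ρ₁(t)² − ρ₂(t)², where for t = Φ(x) one has ρ₁(Φ(x)) = φ(x) and ρ₂(Φ(x)) = φ(x)·x/√2. Then ρ(t,t) < t(1−t) for every t ∈ (0,1), and the ratio tends to one at the boundaries: writing r(x) = Φ(x)(1−Φ(x)) − φ(x)² − x²φ(x)²/2, one has r(x)/[Φ(x)(1−Φ(x))] → 1 as x → −∞ and as x → +∞ (equivalently, lim_{t→0+} ρ(t,t)/[t(1−t)] = lim_{t→1−} ρ(t,t)/[t(1−t)] = 1). -/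

import Mathlib

open MeasureTheory ProbabilityTheory Set Filter

lemma gaussianPDFReal_zero_one_le_of_abs_le {x y : ℝ} (h : |x| ≤ |y|) :
    gaussianPDFReal 0 1 y ≤ gaussianPDFReal 0 1 x := by
  have := sq_le_sq.2 h
  simp only [gaussianPDFReal, sub_zero, NNReal.coe_one, mul_one]
  gcongr

lemma gaussianPDFReal_zero_one_le_measureReal_Ioc {a y : ℝ} (h : ∀ x ∈ Ioc a (a + 1), |x| ≤ |y|) :
    gaussianPDFReal 0 1 y ≤ (gaussianReal 0 1).real (Ioc a (a + 1)) := by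
  have hle : ENNReal.ofReal (gaussianPDFReal 0 1 y) ≤ gaussianReal 0 1 (Ioc a (a + 1)) := by
    rw [gaussianReal_apply 0 one_ne_zero]
    calc ENNReal.ofReal (gaussianPDFReal 0 1 y)
        = ∫⁻ _ in Ioc a (a + 1), ENNReal.ofReal (gaussianPDFReal 0 1 y) := by simp
      _ ≤ ∫⁻ x in Ioc a (a + 1), gaussianPDF 0 1 x :=
        setLIntegral_mono (measurable_gaussianPDF 0 1) fun x hx =>
          ENNReal.ofReal_le_ofReal (gaussianPDFReal_zero_one_le_of_abs_le (h x hx))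
  exact (ENNReal.ofReal_le_iff_le_toReal (measure_ne_top _ _)).1 hle

lemma half_gaussianPDFReal_le_cdf_mul_one_sub (x : ℝ) :
    gaussianPDFReal 0 1 (|x| + 1) / 2 ≤
      (gaussianReal 0 1).real (Iic x) * (1 - (gaussianReal 0 1).real (Iic x)) := by
  have habs : |(|x| + 1)| = |x| + 1 := abs_of_nonneg (by positivity)
  have hlower : gaussianPDFReal 0 1 (|x| + 1) ≤ (gaussianReal 0 1).real (Iic x) := by
    refine (gaussianPDFReal_zero_one_le_measureReal_Ioc (a := x - 1) fun z hz => ?_).trans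
      (measureReal_mono fun z hz => ?_)
    · rw [habs, abs_le]
      constructor <;> linarith [hz.1, hz.2, neg_abs_le x, le_abs_self x]
    · simpa using hz.2
  have hupper : gaussianPDFReal 0 1 (|x| + 1) ≤ 1 - (gaussianReal 0 1).real (Iic x) := by
    rw [← probReal_compl_eq_one_sub measurableSet_Iic, compl_Iic]
    refine (gaussianPDFReal_zero_one_le_measureReal_Ioc (a := x) fun z hz => ?_).trans
      (measureReal_mono Ioc_subset_Ioi_self)
    rw [habs, abs_le]
    constructor <;> linarith [hz.1, hz.2, neg_abs_le x, le_abs_self x]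
  have hpos := gaussianPDFReal_nonneg 0 1 (|x| + 1)
  rcases le_total ((gaussianReal 0 1).real (Iic x)) (1 / 2) with h | h <;> nlinarith

lemma gaussianPDFReal_sq_le_exp_neg_abs_mul (x : ℝ) :
    gaussianPDFReal 0 1 x ^ 2 ≤
      Real.exp (5 / 2) * Real.exp (-|x|) * gaussianPDFReal 0 1 (|x| + 1) := by
  have hc : (√(2 * Real.pi))⁻¹ ≤ 1 :=
    inv_le_one_of_one_le₀ (Real.one_le_sqrt.2 (by linarith [Real.pi_gt_three]))
  have hexp : Real.exp (-x ^ 2 / 2) ^ 2 ≤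
      Real.exp (5 / 2) * Real.exp (-|x|) * Real.exp (-(|x| + 1) ^ 2 / 2) := by
    rw [← Real.exp_nat_mul, ← Real.exp_add, ← Real.exp_add, Real.exp_le_exp]
    push_cast
    nlinarith [sq_nonneg (|x| - 2), sq_abs x]
  simp only [gaussianPDFReal, sub_zero, NNReal.coe_one, mul_one]
  have hc0 : 0 ≤ (√(2 * Real.pi))⁻¹ := by positivity
  calc ((√(2 * Real.pi))⁻¹ * Real.exp (-x ^ 2 / 2)) ^ 2
      = (√(2 * Real.pi))⁻¹ ^ 2 * Real.exp (-x ^ 2 / 2) ^ 2 := mul_pow _ _ _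
    _ ≤ (√(2 * Real.pi))⁻¹ *
        (Real.exp (5 / 2) * Real.exp (-|x|) * Real.exp (-(|x| + 1) ^ 2 / 2)) := by
      gcongr
      exact pow_le_of_le_one hc0 hc two_ne_zero
    _ = _ := by ring

lemma tendsto_sq_add_two_mul_exp_neg_atTop :
    Tendsto (fun y : ℝ => Real.exp (5 / 2) * ((2 + y ^ 2) * Real.exp (-y))) atTop (nhds 0) := by
  have h := ((Real.tendsto_pow_mul_exp_neg_atTop_nhds_zero 0).const_mul 2).add
    (Real.tendsto_pow_mul_exp_neg_atTop_nhds_zero 2)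
  simpa [add_mul] using h.const_mul (Real.exp (5 / 2))

/-- With `Φ` the standard normal CDF, `φ` its density, and
`r(x) = Φ(x)(1−Φ(x)) − φ(x)² − x²φ(x)²/2` (i.e. `ρ(t,t) = t(1−t) − ρ₁(t)² − ρ₂(t)²`
evaluated at `t = Φ(x)`), one has `r(x) < Φ(x)(1−Φ(x))` everywhere (i.e.
`ρ(t,t) < t(1−t)` for all `t ∈ (0,1)`), and `r(x)/[Φ(x)(1−Φ(x))] → 1` as `x → −∞`
and `x → +∞` (i.e. `ρ(t,t)/[t(1−t)] → 1` as `t → 0⁺` and `t → 1⁻`). -/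
theorem gaussian_composite_covariance_diagonal
    (Φ : ℝ → ℝ) (hΦ : ∀ x, Φ x = (gaussianReal 0 1 (Iic x)).toReal)
    (φ : ℝ → ℝ) (hφ : ∀ x, φ x = (Real.sqrt (2 * Real.pi))⁻¹ * Real.exp (-x ^ 2 / 2))
    (r : ℝ → ℝ)
    (hr : ∀ x, r x = Φ x * (1 - Φ x) - φ x ^ 2 - x ^ 2 * φ x ^ 2 / 2) :
    (∀ x : ℝ, r x < Φ x * (1 - Φ x)) ∧
      Tendsto (fun x => r x / (Φ x * (1 - Φ x))) atBot (nhds 1) ∧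
      Tendsto (fun x => r x / (Φ x * (1 - Φ x))) atTop (nhds 1) := by
  have hφpdf (x : ℝ) : φ x = gaussianPDFReal 0 1 x := by simp [hφ, gaussianPDFReal]
  have hφpos (x : ℝ) : 0 < φ x := hφpdf x ▸ gaussianPDFReal_pos 0 1 x one_ne_zero
  have hvar (x : ℝ) : φ (|x| + 1) / 2 ≤ Φ x * (1 - Φ x) := by
    rw [hφpdf, hΦ]
    exact half_gaussianPDFReal_le_cdf_mul_one_sub x
  have hvarpos (x : ℝ) : 0 < Φ x * (1 - Φ x) := by linarith [hvar x, hφpos (|x| + 1)]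
  have hlt (x : ℝ) : r x < Φ x * (1 - Φ x) := by
    rw [hr]
    have := pow_pos (hφpos x) 2
    nlinarith [mul_nonneg (sq_nonneg x) this.le]
  have hlower (x : ℝ) :
      1 - Real.exp (5 / 2) * ((2 + |x| ^ 2) * Real.exp (-|x|)) ≤ r x / (Φ x * (1 - Φ x)) := by
    have hsq := gaussianPDFReal_sq_le_exp_neg_abs_mul x
    rw [← hφpdf, ← hφpdf] at hsq
    have hdefect : φ x ^ 2 + x ^ 2 * φ x ^ 2 / 2 ≤
        Real.exp (5 / 2) * ((2 + |x| ^ 2) * Real.exp (-|x|)) * (Φ x * (1 - Φ x)) := by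
      calc φ x ^ 2 + x ^ 2 * φ x ^ 2 / 2
          = (2 + |x| ^ 2) / 2 * φ x ^ 2 := by rw [sq_abs]; ring
        _ ≤ (2 + |x| ^ 2) / 2 * (Real.exp (5 / 2) * Real.exp (-|x|) * φ (|x| + 1)) := by gcongr
        _ = Real.exp (5 / 2) * ((2 + |x| ^ 2) * Real.exp (-|x|)) * (φ (|x| + 1) / 2) := by ring
        _ ≤ _ := by gcongr; exact hvar x
    rw [le_div_iff₀ (hvarpos x), hr]
    linarith
  have hlim {l : Filter ℝ} (hl : Tendsto (fun x : ℝ => |x|) l atTop) :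
      Tendsto (fun x => r x / (Φ x * (1 - Φ x))) l (nhds 1) := by
    have hbound := (tendsto_sq_add_two_mul_exp_neg_atTop.comp hl).const_sub 1
    rw [sub_zero] at hbound
    exact tendsto_of_tendsto_of_tendsto_of_le_of_le hbound tendsto_const_nhds hlower
      fun x => (div_le_one (hvarpos x)).2 (hlt x).le
  exact ⟨hlt, hlim tendsto_abs_atBot_atTop, hlim tendsto_abs_atTop_atTop⟩
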